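/- Let $p>1$, $K$ a compact metric space, $(X,\sigma)$ a finite measure space, and $F$ a real Banach space. Let $E$ be a closed subspace of $C(K)$ containing the constant function $1$. If $E$ is isometric to a subspace of the Lebesgue–Bochner space $L_p(X;F)$ (i.e. there exists a linear isometry from $E$ into $L_p(X;F)$), then $E$ is isometric to a subspace of $F$: there exists a linear isometry from $E$ into $F$. -/

import Mathlib

open MeasureTheory

theorem Lp_integral_norm_rpow {X F : Type*} [MeasurableSpace X] {σ : Measure X}
    [NormedAddCommGroup F] {p : ℝ} (hp : 1 < p) (u : Lp F (ENNReal.ofReal p) σ) :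
    Integrable (fun x => ‖u x‖ ^ p) σ ∧ ∫ x, ‖u x‖ ^ p ∂σ = ‖u‖ ^ p := by
  have hp0 : 0 < p := by linarith
  have h0 : ENNReal.ofReal p ≠ 0 := by simpa using hp0
  have ht : (ENNReal.ofReal p).toReal = p := ENNReal.toReal_ofReal hp0.le
  have hi := (Lp.memLp u).integrable_norm_rpow h0 ENNReal.ofReal_ne_top
  rw [ht] at hi
  refine ⟨hi, ?_⟩
  have hnn : 0 ≤ ∫ x, ‖u x‖ ^ p ∂σ := integral_nonneg fun x => by positivity
  rw [Lp.norm_def, (Lp.memLp u).eLpNorm_eq_integral_rpow_norm h0 ENNReal.ofReal_ne_top, ht,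
    ENNReal.toReal_ofReal (by positivity), Real.rpow_inv_rpow hnn hp0.ne']

/-- Equality in Minkowski's inequality for unit vectors of `L_p(X; F)`, `1 < p`, forces the
pointwise norms to agree. -/
theorem ae_norm_eq_of_norm_add_eq_two {X F : Type*} [MeasurableSpace X] {σ : Measure X}
    [NormedAddCommGroup F] {p : ℝ} (hp : 1 < p) {u v : Lp F (ENNReal.ofReal p) σ}
    (hu : ‖u‖ = 1) (hv : ‖v‖ = 1) (huv : ‖u + v‖ = 2) :
    ∀ᵐ x ∂σ, ‖u x‖ = ‖v x‖ := by
  obtain ⟨iu, eu⟩ := Lp_integral_norm_rpow hp u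
  obtain ⟨iv, ev⟩ := Lp_integral_norm_rpow hp v
  obtain ⟨iw, ew⟩ := Lp_integral_norm_rpow hp (u + v)
  rw [hu, Real.one_rpow] at eu
  rw [hv, Real.one_rpow] at ev
  rw [huv] at ew
  have h2 : (0 : ℝ) < 2 ^ p := by positivity
  set h : X → ℝ := fun x => (1 / 2 * ‖u x‖ ^ p + 1 / 2 * ‖v x‖ ^ p) - (2 ^ p)⁻¹ * ‖(u + v) x‖ ^ p
  have hmid (x : X) (hx : (u + v) x = u x + v x) :
      (2 ^ p)⁻¹ * ‖(u + v) x‖ ^ p ≤ (1 / 2 * ‖u x‖ + 1 / 2 * ‖v x‖) ^ p := by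
    rw [hx, ← Real.inv_rpow (by norm_num), ← Real.mul_rpow (by norm_num) (norm_nonneg _)]
    refine Real.rpow_le_rpow (by positivity) ?_ (by linarith)
    linarith [norm_add_le (u x) (v x)]
  have hadd : ∀ᵐ x ∂σ, (u + v) x = u x + v x := Lp.coeFn_add u v
  have hnn : 0 ≤ᵐ[σ] h := by
    filter_upwards [hadd] with x hx
    have := (convexOn_rpow hp.le).2 (norm_nonneg (u x)) (norm_nonneg (v x))
      (by norm_num : (0 : ℝ) ≤ 1 / 2) (by norm_num : (0 : ℝ) ≤ 1 / 2) (by norm_num)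
    simp only [smul_eq_mul] at this
    exact sub_nonneg.2 ((hmid x hx).trans this)
  have iuv : Integrable (fun x => 1 / 2 * ‖u x‖ ^ p + 1 / 2 * ‖v x‖ ^ p) σ :=
    (iu.const_mul _).add (iv.const_mul _)
  have hint : ∫ x, h x ∂σ = 0 := by
    rw [integral_sub iuv (iw.const_mul _), integral_add (iu.const_mul _) (iv.const_mul _),
      integral_const_mul, integral_const_mul, integral_const_mul, eu, ev, ew,
      inv_mul_cancel₀ h2.ne']
    norm_num
  have hzero := (integral_eq_zero_iff_of_nonneg_ae hnn (iuv.sub (iw.const_mul _))).1 hint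
  filter_upwards [hadd, hzero] with x hx hx0
  by_contra hne
  have := (strictConvexOn_rpow hp).2 (norm_nonneg (u x)) (norm_nonneg (v x)) hne
    (by norm_num : (0 : ℝ) < 1 / 2) (by norm_num : (0 : ℝ) < 1 / 2) (by norm_num)
  simp only [smul_eq_mul] at this
  have h0 : (1 / 2 * ‖u x‖ ^ p + 1 / 2 * ‖v x‖ ^ p) - (2 ^ p)⁻¹ * ‖(u + v) x‖ ^ p = 0 := hx0
  linarith [hmid x hx]

theorem ContinuousMap.exists_norm_one_add_smul_eq {K : Type*} [TopologicalSpace K]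
    [CompactSpace K] [Nonempty K] (f : C(K, ℝ)) (hf : ‖f‖ = 1) :
    ∃ s : ℝ, |s| = 1 ∧ ‖1 + s • f‖ = 2 := by
  obtain ⟨t, ht⟩ := (map_continuous f).norm.exists_forall_ge_of_hasCompactSupport
    (HasCompactSupport.of_compactSpace _)
  have ht1 : |f t| = 1 := by
    refine le_antisymm (hf ▸ f.norm_coe_le_norm t) ?_
    rw [← hf]
    exact (ContinuousMap.norm_le f (abs_nonneg _)).2 ht
  refine ⟨f t, ht1, le_antisymm ?_ ?_⟩
  · calc ‖1 + f t • f‖ ≤ ‖(1 : C(K, ℝ))‖ + ‖f t • f‖ := norm_add_le _ _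
      _ = 2 := by rw [norm_one, norm_smul, hf, Real.norm_eq_abs, ht1]; norm_num
  · have h := (1 + f t • f).norm_coe_le_norm t
    have hsq : f t * f t = 1 := by rw [← abs_mul_abs_self, ht1, one_mul]
    simp only [ContinuousMap.add_apply, ContinuousMap.one_apply, ContinuousMap.smul_apply,
      smul_eq_mul, hsq] at h
    norm_num at h
    exact h

/-- A norm-preserving additive map on a dense subgroup of a real normed space extends to a linear
isometry. -/
theorem nonempty_linearIsometry_of_dense_addSubgroup {E F : Type*} [NormedAddCommGroup E]
    [NormedSpace ℝ E] [NormedAddCommGroup F] [NormedSpace ℝ F] [CompleteSpace F]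
    (V : AddSubgroup E) (hV : Dense (V : Set E)) (φ : V →+ F) (hφ : ∀ v, ‖φ v‖ = ‖v‖) :
    Nonempty (E →ₗᵢ[ℝ] F) := by
  have hdr : DenseRange ((↑) : V → E) := hV.denseRange_val
  have hui : IsUniformInducing ((↑) : V → E) := isUniformEmbedding_subtype_val.isUniformInducing
  have huc : UniformContinuous φ := (AddMonoidHomClass.isometry_of_norm φ hφ).uniformContinuous
  have hdi := hui.isDenseInducing hdr
  set g : E → F := hdi.extend φ
  have hg : Continuous g := (uniformContinuous_uniformly_extend hui hdr huc).continuous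
  have hgV (v : V) : g v = φ v := uniformly_extend_of_ind hui hdr huc v
  have hadd (a b : E) : g (a + b) = g a + g b := by
    refine hdr.induction_on₂ (p := fun a b => g (a + b) = g a + g b)
      (isClosed_eq (by fun_prop) (by fun_prop)) (fun v w => ?_) a b
    rw [← AddSubgroup.coe_add, hgV, hgV, hgV, map_add]
  have hnorm (a : E) : ‖g a‖ = ‖a‖ := by
    refine hdr.induction_on (p := fun a => ‖g a‖ = ‖a‖) a
      (isClosed_eq (by fun_prop) (by fun_prop)) (fun v => ?_)
    rw [hgV, hφ, AddSubgroup.coe_norm]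
  exact ⟨⟨((AddMonoidHom.mk' g hadd).toRealLinearMap hg).toLinearMap, hnorm⟩⟩

/-- Let `e` be a unit vector such that every unit vector `f` satisfies `‖e + s • f‖ = 2` for some
sign `s`. A linear isometry into `L_p(X; F)`, `1 < p`, then sends every `f` to a function whose
pointwise norm is `‖f‖` times that of the image of `e`. -/
theorem ae_norm_apply_eq_norm_mul {E X F : Type*} [NormedAddCommGroup E] [NormedSpace ℝ E]
    [MeasurableSpace X] {σ : Measure X} [NormedAddCommGroup F] [NormedSpace ℝ F]
    {p : ℝ} (hp : 1 < p) [Fact (1 ≤ ENNReal.ofReal p)]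
    (T : E →ₗᵢ[ℝ] Lp F (ENNReal.ofReal p) σ) {e : E} (he : ‖e‖ = 1)
    (hpeak : ∀ f : E, ‖f‖ = 1 → ∃ s : ℝ, |s| = 1 ∧ ‖e + s • f‖ = 2) (f : E) :
    ∀ᵐ x ∂σ, ‖T f x‖ = ‖f‖ * ‖T e x‖ := by
  by_cases hf : f = 0
  · subst hf
    rw [T.map_zero]
    filter_upwards [Lp.coeFn_zero F (ENNReal.ofReal p) σ] with x hx
    rw [hx, Pi.zero_apply, norm_zero, norm_zero, zero_mul]
  have hf' : ‖f‖ ≠ 0 := norm_ne_zero_iff.2 hf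
  have hnf : ‖‖f‖⁻¹ • f‖ = 1 := by
    rw [norm_smul, norm_inv, norm_norm, inv_mul_cancel₀ hf']
  obtain ⟨s, hs, hs2⟩ := hpeak _ hnf
  rw [smul_smul] at hs2
  set c : ℝ := s * ‖f‖⁻¹
  have hc : |c| = ‖f‖⁻¹ := by simp [c, abs_mul, hs]
  have hcf : ‖T (c • f)‖ = 1 := by
    rw [T.norm_map, norm_smul, Real.norm_eq_abs, hc, inv_mul_cancel₀ hf']
  have hsum : ‖T e + T (c • f)‖ = 2 := by rw [← T.map_add, T.norm_map, hs2]
  have hsm : T (c • f) =ᵐ[σ] c • ⇑(T f) := by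
    rw [T.map_smul]
    exact Lp.coeFn_smul c (T f)
  filter_upwards [ae_norm_eq_of_norm_add_eq_two hp ((T.norm_map e).trans he) hcf hsum, hsm]
    with x hx hx'
  rw [hx, hx', Pi.smul_apply, norm_smul, Real.norm_eq_abs, hc, mul_inv_cancel_left₀ hf']

theorem AddSubgroup.countable_closure {G : Type*} [AddCommGroup G] {s : Set G}
    (hs : s.Countable) : Countable (AddSubgroup.closure s) := by
  have := hs.to_subtype
  rw [← Submodule.span_int_eq_addSubgroupClosure]
  have h : Function.Surjective (Finsupp.linearCombination ℤ ((↑) : s → G)).rangeRestrict :=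
    LinearMap.surjective_rangeRestrict _
  have hc := h.countable
  rwa [Finsupp.range_linearCombination, Subtype.range_coe] at hc

theorem nonempty_linearIsometry_of_linearIsometry_Lp {E X F : Type*} [NormedAddCommGroup E]
    [NormedSpace ℝ E] [TopologicalSpace.SeparableSpace E] [MeasurableSpace X] {σ : Measure X}
    [NormedAddCommGroup F] [NormedSpace ℝ F] [CompleteSpace F]
    {p : ℝ} (hp : 1 < p) [Fact (1 ≤ ENNReal.ofReal p)]
    (T : E →ₗᵢ[ℝ] Lp F (ENNReal.ofReal p) σ) {e : E} (he : ‖e‖ = 1)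
    (hpeak : ∀ f : E, ‖f‖ = 1 → ∃ s : ℝ, |s| = 1 ∧ ‖e + s • f‖ = 2) :
    Nonempty (E →ₗᵢ[ℝ] F) := by
  let V : AddSubgroup E := AddSubgroup.closure (Set.range (TopologicalSpace.denseSeq E))
  have hVd : Dense (V : Set E) :=
    Dense.mono AddSubgroup.subset_closure (TopologicalSpace.denseRange_denseSeq E)
  have hVc : Countable V := AddSubgroup.countable_closure (Set.countable_range _)
  have hnorm : ∀ᵐ x ∂σ, ∀ v : V, ‖T v x‖ = ‖(v : E)‖ * ‖T e x‖ :=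
    ae_all_iff.2 fun v => ae_norm_apply_eq_norm_mul hp T he hpeak v
  have hadd : ∀ᵐ x ∂σ, ∀ v w : V, T (v + w : E) x = T v x + T w x := by
    refine ae_all_iff.2 fun v => ae_all_iff.2 fun w => ?_
    rw [T.map_add]
    exact Lp.coeFn_add _ _
  have hne : ∃ᵐ x ∂σ, T e x ≠ 0 := by
    intro h
    have hz : T e = 0 := by
      refine (Lp.eq_zero_iff_ae_eq_zero).2 ?_
      filter_upwards [h] with x hx using not_not.1 hx
    rw [← T.norm_map, hz, norm_zero] at he
    exact zero_ne_one he
  obtain ⟨x, hx0, hxn, hxa⟩ := (hne.and_eventually (hnorm.and hadd)).exists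
  have hx0' : ‖T e x‖ ≠ 0 := norm_ne_zero_iff.2 hx0
  refine nonempty_linearIsometry_of_dense_addSubgroup V hVd
    (AddMonoidHom.mk' (fun v : V => ‖T e x‖⁻¹ • T v x) fun v w => ?_) fun v => ?_
  · rw [AddSubgroup.coe_add, hxa, smul_add]
  · rw [AddMonoidHom.mk'_apply, norm_smul, hxn, norm_inv, norm_norm, mul_comm ‖(v : E)‖,
      inv_mul_cancel_left₀ hx0', AddSubgroup.coe_norm]

/-- If a closed subspace `E` of `C(K)` containing the constant function `1` embeds
isometrically into `L_p(X; F)` for some `p > 1` and finite `σ`, then `E` embeds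
isometrically into `F`. -/
theorem subspace_C_K_embeds_in_F
    {K : Type*} [MetricSpace K] [CompactSpace K]
    {F : Type*} [NormedAddCommGroup F] [NormedSpace ℝ F] [CompleteSpace F]
    {X : Type*} [MeasurableSpace X] (σ : Measure X) [IsFiniteMeasure σ]
    {p : ℝ} (hp : 1 < p) [Fact (1 ≤ ENNReal.ofReal p)]
    (E : Subspace ℝ C(K, ℝ)) (hE : IsClosed (E : Set C(K, ℝ)))
    (h1 : (1 : C(K, ℝ)) ∈ E)
    (hemb : Nonempty (E →ₗᵢ[ℝ] Lp F (ENNReal.ofReal p) σ)) :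
    Nonempty (E →ₗᵢ[ℝ] F) := by
  obtain ⟨T⟩ := hemb
  cases isEmpty_or_nonempty K with
  | inl hK =>
    have hz (e : E) : e = 0 := Subtype.ext (ContinuousMap.ext fun x => hK.elim x)
    refine ⟨⟨0, fun e => ?_⟩⟩
    rw [hz e, map_zero, norm_zero]
    exact norm_zero.symm
  | inr hK =>
    let e₁ : E := ⟨1, h1⟩
    have he₁ : ‖e₁‖ = 1 := norm_one (α := C(K, ℝ))
    have hpeak (f : E) (hf : ‖f‖ = 1) : ∃ s : ℝ, |s| = 1 ∧ ‖e₁ + s • f‖ = 2 :=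
      ContinuousMap.exists_norm_one_add_smul_eq f.1 hf
    exact nonempty_linearIsometry_of_linearIsometry_Lp hp T he₁ hpeak
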